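/- Let S = (S_x | x ∈ D) be a monotone family of semiintervals of a linear order (D,<) such that S_x^2 ≠ S_x for every x ∈ D. Then S_x is a shift for every x ∈ D, i.e., for every x ∈ D the sequence of powers (S_x^n)_{n ≥ 1} is strictly increasing under inclusion. -/

import Mathlib

namespace SemiIntervalFamilies

/-- The `n`-th power of a family of semiintervals, indexed so that `famPow S 1 x = S x`
and `famPow S (n+1) x = ⋃ t ∈ famPow S n x, S t`. -/
def famPow {D : Type*} (S : D → Set D) : ℕ → D → Set D
  | 0, x => {x}
  | n + 1, x => ⋃ t ∈ famPow S n x, S t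

/-- `S` is a family of semiintervals of the linear order `D`: each `S x` is convex
and has minimum element `x`. -/
def IsSemiIntervalFamily {D : Type*} [LinearOrder D] (S : D → Set D) : Prop :=
  ∀ x : D, (∀ a ∈ S x, ∀ b ∈ S x, ∀ c : D, a ≤ c → c ≤ b → c ∈ S x) ∧
    x ∈ S x ∧ (∀ y ∈ S x, x ≤ y)

/-- The smallest initial part of `D` containing `X`. -/
def supin {D : Type*} [LinearOrder D] (X : Set D) : Set D :=
  {d : D | ∃ x ∈ X, d ≤ x}

/-- The family `S` is monotone if `x ≤ y` implies `supin (S x) ⊆ supin (S y)`. -/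
def IsMonotoneFamily {D : Type*} [LinearOrder D] (S : D → Set D) : Prop :=
  ∀ x y : D, x ≤ y → supin (S x) ⊆ supin (S y)

/-- `S a` is a shift: the sequence of powers `(S_a^n)_{n ≥ 1}` is strictly
increasing under inclusion. -/
def IsShift {D : Type*} (S : D → Set D) (a : D) : Prop :=
  ∀ n : ℕ, 1 ≤ n → famPow S n a ⊂ famPow S (n + 1) a

/-- The convex hull of a subset of a linear order. -/
def conv {D : Type*} [LinearOrder D] (X : Set D) : Set D :=
  {d : D | ∃ a ∈ X, ∃ b ∈ X, a ≤ d ∧ d ≤ b}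

end SemiIntervalFamilies

open SemiIntervalFamilies

namespace SemiIntervalFamilies

variable {D : Type*} {S : D → Set D}

theorem mem_famPow_succ {n : ℕ} {x z : D} :
    z ∈ famPow S (n + 1) x ↔ ∃ t ∈ famPow S n x, z ∈ S t := by
  simp [famPow]

theorem famPow_one (x : D) : famPow S 1 x = S x := by
  simp [famPow]

variable [LinearOrder D]

theorem IsSemiIntervalFamily.famPow_subset_succ (hS : IsSemiIntervalFamily S) (n : ℕ) (x : D) :
    famPow S n x ⊆ famPow S (n + 1) x :=
  fun z hz => mem_famPow_succ.2 ⟨z, hz, (hS z).2.1⟩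

theorem IsSemiIntervalFamily.le_of_mem_famPow (hS : IsSemiIntervalFamily S) {n : ℕ} {x z : D}
    (hz : z ∈ famPow S n x) : x ≤ z := by
  induction n generalizing z with
  | zero => exact (Set.mem_singleton_iff.1 hz).ge
  | succ n ih =>
    obtain ⟨t, ht, hzt⟩ := mem_famPow_succ.1 hz
    exact (ih ht).trans ((hS t).2.2 z hzt)

/-- Powers of a semiinterval contain every point between their minimum and one of their
elements. -/
theorem IsSemiIntervalFamily.mem_famPow_of_le (hS : IsSemiIntervalFamily S) {n : ℕ} {x t u : D}
    (hu : u ∈ famPow S n x) (hxt : x ≤ t) (htu : t ≤ u) : t ∈ famPow S n x := by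
  induction n generalizing u with
  | zero => exact le_antisymm (htu.trans (Set.mem_singleton_iff.1 hu).le) hxt
  | succ n ih =>
    obtain ⟨s, hs, hus⟩ := mem_famPow_succ.1 hu
    rcases le_total t s with hts | hst
    · exact hS.famPow_subset_succ n x (ih hs hts)
    · exact mem_famPow_succ.2 ⟨s, hs, (hS s).1 s (hS s).2.1 u hus t hst htu⟩

/-- If the powers of `S x` stabilize at `n + 1`, then `S t` is idempotent for every `t` that is
in the power `n + 1` but not in the power `n`. -/
theorem IsSemiIntervalFamily.famPow_two_eq (hS : IsSemiIntervalFamily S)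
    (hmono : IsMonotoneFamily S) {n : ℕ} {x t : D} (ht : t ∈ famPow S (n + 1) x)
    (htn : t ∉ famPow S n x) (hstab : famPow S (n + 2) x ⊆ famPow S (n + 1) x) :
    famPow S 2 t = S t := by
  refine Set.Subset.antisymm (fun z hz => ?_) (famPow_one (S := S) t ▸ hS.famPow_subset_succ 1 t)
  have htz : t ≤ z := hS.le_of_mem_famPow hz
  obtain ⟨w, hw, hzw⟩ := mem_famPow_succ.1 hz
  rw [famPow_one] at hw
  have hwx : w ∈ famPow S (n + 1) x := hstab (mem_famPow_succ.2 ⟨t, ht, hw⟩)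
  obtain ⟨u, hu, hzu⟩ := mem_famPow_succ.1 (hstab (mem_famPow_succ.2 ⟨w, hwx, hzw⟩))
  have hut : u ≤ t := le_of_not_ge fun htu =>
    htn (hS.mem_famPow_of_le hu (hS.le_of_mem_famPow ht) htu)
  obtain ⟨v, hv, hzv⟩ := hmono u t hut ⟨z, hzu, le_rfl⟩
  exact (hS t).1 t (hS t).2.1 v hv z htz hzv

end SemiIntervalFamilies

/-- If a monotone family of semiintervals satisfies `S_x^2 ≠ S_x` for every `x`, then
every `S_x` is a shift. -/
theorem isShift_of_sq_ne {D : Type*} [LinearOrder D] (S : D → Set D)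
    (hS : IsSemiIntervalFamily S) (hmono : IsMonotoneFamily S)
    (h : ∀ x : D, famPow S 2 x ≠ S x) :
    ∀ x : D, IsShift S x := by
  intro x n hn
  induction n, hn using Nat.le_induction with
  | base =>
    refine (hS.famPow_subset_succ 1 x).ssubset_of_ne fun heq => h x ?_
    rw [← heq, famPow_one]
  | succ n _ ih =>
    refine ⟨hS.famPow_subset_succ (n + 1) x, fun hstab => ?_⟩
    obtain ⟨t, ht, htn⟩ := Set.exists_of_ssubset ih
    exact h t (hS.famPow_two_eq hmono ht htn hstab)
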